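/- Let α ∈ [0,2] and let ν be a measure on ℝ ∖ {0} satisfying Assumption (A1). Then for every δ > α there is a constant C > 0 such that ∫_{0<|x|≤ε} |x|^δ ν(dx) ≤ C ε^{δ−α} for all sufficiently small ε > 0; in particular, ∫_{0<|x|≤ε} |x|³ ν(dx) = O(ε^{3−α}) and ∫_{0<|x|≤ε} x⁴ ν(dx) = O(ε^{4−α}) as ε → 0⁺. -/

import Mathlib

open MeasureTheory

lemma rpow_le_two_rpow_abs {t : ℝ} (ht : 1 / 2 ≤ t) (ht1 : t ≤ 1) (s : ℝ) :
    t ^ s ≤ 2 ^ |s| := by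
  have ht0 : 0 < t := by linarith
  calc t ^ s ≤ t ^ (-|s|) := Real.rpow_le_rpow_of_exponent_ge ht0 ht1 (neg_abs_le s)
    _ = t⁻¹ ^ |s| := by rw [Real.rpow_neg ht0.le, Real.inv_rpow ht0.le]
    _ ≤ 2 ^ |s| := by
      refine Real.rpow_le_rpow (by positivity) ?_ (abs_nonneg s)
      rw [inv_le_comm₀ ht0 two_pos]
      linarith

/-- On the dyadic shell `r / 2 < |x| ≤ r` the power `|x| ^ δ` is comparable to
`r ^ (δ - 2) * x ^ 2`. -/
lemma abs_rpow_le_of_mem_shell {r x : ℝ} (hr : 0 < r) (hx : r / 2 < |x|) (hxr : |x| ≤ r)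
    (δ : ℝ) : |x| ^ δ ≤ 2 ^ |δ - 2| * r ^ (δ - 2) * x ^ 2 := by
  have hx0 : 0 < |x| := by linarith
  have h := rpow_le_two_rpow_abs (t := |x| / r) (by rw [le_div_iff₀ hr]; linarith)
    ((div_le_one hr).2 hxr) (δ - 2)
  rw [Real.div_rpow hx0.le hr.le, div_le_iff₀ (by positivity)] at h
  calc |x| ^ δ = |x| ^ (δ - 2) * x ^ 2 := by
        rw [← sq_abs x, ← Real.rpow_two, ← Real.rpow_add hx0, sub_add_cancel]
    _ ≤ _ := by gcongr

lemma setLIntegral_shell_abs_rpow_le {ν : Measure ℝ} {α c r : ℝ} (hr : 0 < r)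
    (h : ∫⁻ x in {x : ℝ | x ≠ 0 ∧ |x| ≤ r}, ENNReal.ofReal (x ^ 2) ∂ν ≤
      ENNReal.ofReal (c * r ^ (2 - α))) (δ : ℝ) :
    ∫⁻ x in {x : ℝ | r / 2 < |x| ∧ |x| ≤ r}, ENNReal.ofReal (|x| ^ δ) ∂ν ≤
      ENNReal.ofReal (2 ^ |δ - 2| * c * r ^ (δ - α)) := by
  have hmeas : MeasurableSet {x : ℝ | r / 2 < |x| ∧ |x| ≤ r} :=
    (measurableSet_lt measurable_const continuous_abs.measurable).inter
      (measurableSet_le continuous_abs.measurable measurable_const)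
  have hK : (0 : ℝ) ≤ 2 ^ |δ - 2| * r ^ (δ - 2) := by positivity
  calc ∫⁻ x in {x : ℝ | r / 2 < |x| ∧ |x| ≤ r}, ENNReal.ofReal (|x| ^ δ) ∂ν
      ≤ ∫⁻ x in {x : ℝ | r / 2 < |x| ∧ |x| ≤ r},
          ENNReal.ofReal (2 ^ |δ - 2| * r ^ (δ - 2)) * ENNReal.ofReal (x ^ 2) ∂ν := by
        refine setLIntegral_mono' hmeas fun x hx => ?_
        rw [← ENNReal.ofReal_mul hK]
        exact ENNReal.ofReal_le_ofReal (abs_rpow_le_of_mem_shell hr hx.1 hx.2 δ)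
    _ = ENNReal.ofReal (2 ^ |δ - 2| * r ^ (δ - 2)) *
          ∫⁻ x in {x : ℝ | r / 2 < |x| ∧ |x| ≤ r}, ENNReal.ofReal (x ^ 2) ∂ν :=
        lintegral_const_mul' _ _ ENNReal.ofReal_ne_top
    _ ≤ ENNReal.ofReal (2 ^ |δ - 2| * r ^ (δ - 2)) * ENNReal.ofReal (c * r ^ (2 - α)) := by
        gcongr
        refine le_trans (lintegral_mono_set ?_) h
        exact fun x hx => ⟨abs_pos.1 ((half_pos hr).trans hx.1), hx.2⟩
    _ = ENNReal.ofReal (2 ^ |δ - 2| * c * r ^ (δ - α)) := by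
        rw [← ENNReal.ofReal_mul hK]
        congr 1
        rw [show δ - α = (δ - 2) + (2 - α) by ring, Real.rpow_add hr]
        ring

/-- A bound of order `ε ^ (2 - α)` on the truncated second moments gives a bound of order
`ε ^ (δ - α)` on the truncated absolute moments of every order `δ > α`. -/
lemma exists_setLIntegral_abs_rpow_le {ν : Measure ℝ} {α c ε₀ : ℝ} (hc : 0 < c)
    (h : ∀ ε : ℝ, 0 < ε → ε ≤ ε₀ →
      ∫⁻ x in {x : ℝ | x ≠ 0 ∧ |x| ≤ ε}, ENNReal.ofReal (x ^ 2) ∂ν ≤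
        ENNReal.ofReal (c * ε ^ (2 - α))) {δ : ℝ} (hδ : α < δ) :
    ∃ C : ℝ, 0 < C ∧ ∀ ε : ℝ, 0 < ε → ε ≤ ε₀ →
      ∫⁻ x in {x : ℝ | x ≠ 0 ∧ |x| ≤ ε}, ENNReal.ofReal (|x| ^ δ) ∂ν ≤
        ENNReal.ofReal (C * ε ^ (δ - α)) := by
  set q : ℝ := (1 / 2) ^ (δ - α) with hq
  have hq0 : 0 < q := by positivity
  have hq1 : q < 1 := Real.rpow_lt_one (by norm_num) (by norm_num) (by linarith)
  refine ⟨2 ^ |δ - 2| * c * (1 - q)⁻¹, mul_pos (by positivity) (inv_pos.2 (by linarith)), ?_⟩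
  intro ε hε hεle
  have hr (n : ℕ) : 0 < ε * (1 / 2) ^ n := by positivity
  have hrle (n : ℕ) : ε * (1 / 2) ^ n ≤ ε₀ :=
    (mul_le_of_le_one_right hε.le (pow_le_one₀ (by norm_num) (by norm_num))).trans hεle
  have hcover : {x : ℝ | x ≠ 0 ∧ |x| ≤ ε} ⊆
      ⋃ n : ℕ, {x : ℝ | ε * (1 / 2) ^ n / 2 < |x| ∧ |x| ≤ ε * (1 / 2) ^ n} := by
    rintro x ⟨hx0, hxε⟩
    obtain ⟨n, hn, hn'⟩ := exists_nat_pow_near_of_lt_one (x := |x| / ε) (y := (1 / 2 : ℝ))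
      (div_pos (abs_pos.2 hx0) hε) ((div_le_one hε).2 hxε) (by norm_num) (by norm_num)
    rw [lt_div_iff₀ hε, pow_succ] at hn
    rw [div_le_iff₀ hε] at hn'
    exact Set.mem_iUnion.2 ⟨n, by linarith, by linarith⟩
  have hsum : HasSum (fun n : ℕ => 2 ^ |δ - 2| * c * ε ^ (δ - α) * q ^ n)
      (2 ^ |δ - 2| * c * ε ^ (δ - α) * (1 - q)⁻¹) :=
    (hasSum_geometric_of_lt_one hq0.le hq1).mul_left _
  calc ∫⁻ x in {x : ℝ | x ≠ 0 ∧ |x| ≤ ε}, ENNReal.ofReal (|x| ^ δ) ∂ν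
      ≤ ∑' n : ℕ, ∫⁻ x in {x : ℝ | ε * (1 / 2) ^ n / 2 < |x| ∧ |x| ≤ ε * (1 / 2) ^ n},
          ENNReal.ofReal (|x| ^ δ) ∂ν :=
        (lintegral_mono_set hcover).trans (lintegral_iUnion_le _ _)
    _ ≤ ∑' n : ℕ, ENNReal.ofReal (2 ^ |δ - 2| * c * ε ^ (δ - α) * q ^ n) := by
        refine ENNReal.tsum_le_tsum fun n => ?_
        refine (setLIntegral_shell_abs_rpow_le (hr n) (h _ (hr n) (hrle n)) δ).trans_eq ?_
        rw [Real.mul_rpow hε.le (by positivity), hq, ← Real.rpow_pow_comm (by norm_num)]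
        congr 1
        ring
    _ = ENNReal.ofReal (2 ^ |δ - 2| * c * (1 - q)⁻¹ * ε ^ (δ - α)) := by
        rw [← ENNReal.ofReal_tsum_of_nonneg (fun n => by positivity) hsum.summable, hsum.tsum_eq]
        congr 1
        ring

/-- Under Assumption (A1), for every `δ > α` there is `C > 0` with
`∫_{0<|x|≤ε} |x|^δ ν(dx) ≤ C ε^{δ−α}` for all sufficiently small `ε > 0`; in
particular `∫_{0<|x|≤ε} |x|³ ν(dx) = O(ε^{3−α})` and
`∫_{0<|x|≤ε} x⁴ ν(dx) = O(ε^{4−α})` as `ε → 0⁺`. -/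
theorem truncated_moments_bound
    (α : ℝ) (hα : α ∈ Set.Icc (0 : ℝ) 2)
    (ν : Measure ℝ)
    (c₁ c₂ ε₀ : ℝ) (hc₁ : 0 < c₁) (hc₁₂ : c₁ ≤ c₂) (hε₀ : 0 < ε₀) (hε₀1 : ε₀ ≤ 1)
    (hA1 : ∀ ε : ℝ, 0 < ε → ε ≤ ε₀ →
      ENNReal.ofReal (c₁ * ε ^ (2 - α)) ≤
          (∫⁻ x in {x : ℝ | x ≠ 0 ∧ |x| ≤ ε}, ENNReal.ofReal (x ^ 2) ∂ν) ∧
        (∫⁻ x in {x : ℝ | x ≠ 0 ∧ |x| ≤ ε}, ENNReal.ofReal (x ^ 2) ∂ν) ≤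
          ENNReal.ofReal (c₂ * ε ^ (2 - α))) :
    (∀ δ : ℝ, α < δ → ∃ C : ℝ, 0 < C ∧ ∃ ε₁ : ℝ, 0 < ε₁ ∧ ∀ ε : ℝ, 0 < ε → ε ≤ ε₁ →
        (∫⁻ x in {x : ℝ | x ≠ 0 ∧ |x| ≤ ε}, ENNReal.ofReal (|x| ^ δ) ∂ν) ≤
          ENNReal.ofReal (C * ε ^ (δ - α))) ∧
      (∃ C : ℝ, 0 < C ∧ ∃ ε₁ : ℝ, 0 < ε₁ ∧ ∀ ε : ℝ, 0 < ε → ε ≤ ε₁ →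
        (∫⁻ x in {x : ℝ | x ≠ 0 ∧ |x| ≤ ε}, ENNReal.ofReal (|x| ^ 3) ∂ν) ≤
          ENNReal.ofReal (C * ε ^ (3 - α))) ∧
      (∃ C : ℝ, 0 < C ∧ ∃ ε₁ : ℝ, 0 < ε₁ ∧ ∀ ε : ℝ, 0 < ε → ε ≤ ε₁ →
        (∫⁻ x in {x : ℝ | x ≠ 0 ∧ |x| ≤ ε}, ENNReal.ofReal (x ^ 4) ∂ν) ≤
          ENNReal.ofReal (C * ε ^ (4 - α))) := by
  have key (δ : ℝ) (hδ : α < δ) := exists_setLIntegral_abs_rpow_le (hc₁.trans_le hc₁₂)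
    (fun ε hε hεle => (hA1 ε hε hεle).2) hδ
  refine ⟨fun δ hδ => ?_, ?_, ?_⟩
  · obtain ⟨C, hC, h⟩ := key δ hδ
    exact ⟨C, hC, ε₀, hε₀, h⟩
  · obtain ⟨C, hC, h⟩ := key 3 (by linarith [hα.2])
    refine ⟨C, hC, ε₀, hε₀, fun ε hε hεle => ?_⟩
    simpa only [Real.rpow_ofNat] using h ε hε hεle
  · obtain ⟨C, hC, h⟩ := key 4 (by linarith [hα.2])
    refine ⟨C, hC, ε₀, hε₀, fun ε hε hεle => ?_⟩
    simpa only [Real.rpow_ofNat, Even.pow_abs (by decide : Even 4)]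
      using h ε hε hεle
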